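/- Let 𝕂 = ℝ or 𝕂 = ℂ, let M be a compact Hausdorff space such that C(M;ℂ) is isometrically isomorphic as a complex Banach algebra to L^∞(𝕋), and let ι be a nonempty type of cardinality at most 𝔠. Then C(M ⊕ 𝕋^ι ⊕ OnePoint ℕ; 𝕂) admits an isometric shift, where 𝕋^ι = (ι → 𝕋) carries the product topology. -/

import Mathlib

open Topology

/-- `T` is an isometric shift: an isometry whose range has codimension 1 and with
`⋂_{n≥1} Tⁿ(E) = {0}`. -/
def IsIsometricShift {𝕜 E : Type*} [RCLike 𝕜] [NormedAddCommGroup E] [NormedSpace 𝕜 E]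
    (T : E →L[𝕜] E) : Prop :=
  (∀ f, ‖T f‖ = ‖f‖) ∧
    Module.rank 𝕜 (E ⧸ LinearMap.range (T : E →ₗ[𝕜] E)) = 1 ∧
    (⋂ n : ℕ, Set.range ((⇑T)^[n + 1])) = {0}

open MeasureTheory in
instance : Fact (0 < 2 * Real.pi) := ⟨by positivity⟩

open MeasureTheory in
/-- `C(M, ℂ)` is isometrically isomorphic, as a complex Banach algebra, to `L^∞(𝕋)`
(realized as `Lp ℂ ∞` of the circle `ℝ/2πℤ` with Lebesgue/Haar measure): there is a
complex-linear isometric equivalence which is moreover multiplicative (hence a Banach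
algebra isomorphism). -/
def IsCMIsoLinftyCircle (M : Type*) [TopologicalSpace M] [CompactSpace M] : Prop :=
  ∃ e : C(M, ℂ) ≃ₗᵢ[ℂ] Lp ℂ ⊤ (volume : Measure (AddCircle (2 * Real.pi))),
    ∀ f g : C(M, ℂ),
      ((e (f * g) : AddCircle (2 * Real.pi) →ₘ[volume] ℂ)) = ↑(e f) * ↑(e g)


section Kronecker

open Filter Finset

variable {κ : Type*}

/-- The monomial `x ↦ ∏ xᵢ ^ nᵢ` on the torus `κ → Circle`. -/
noncomputable def torusMonomial (n : κ →₀ ℤ) (x : κ → Circle) : Circle :=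
  n.prod fun i k => x i ^ k

lemma torusMonomial_mul (n : κ →₀ ℤ) (x y : κ → Circle) :
    torusMonomial n (x * y) = torusMonomial n x * torusMonomial n y := by
  simp [torusMonomial, Finsupp.prod, mul_zpow, Finset.prod_mul_distrib]

lemma torusMonomial_pow (n : κ →₀ ℤ) (x : κ → Circle) (k : ℕ) :
    torusMonomial n (x ^ k) = torusMonomial n x ^ k := by
  induction k with
  | zero => simp [torusMonomial]
  | succ k ih => rw [pow_succ, torusMonomial_mul, ih, pow_succ]

/-- Difference of the Cesàro means of `F` along the orbits `y * ρ ^ n` and `ρ ^ n`. -/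
noncomputable def cesaroDiff (ρ y : κ → Circle) (N : ℕ) : C(κ → Circle, ℂ) →ₗ[ℂ] ℂ where
  toFun F := (N : ℂ)⁻¹ * ∑ n ∈ range N, (F (y * ρ ^ n) - F (ρ ^ n))
  map_add' F G := by
    rw [← mul_add, ← sum_add_distrib]
    congr 1
    exact sum_congr rfl fun n _ => by simp; ring
  map_smul' c F := by
    simp only [ContinuousMap.smul_apply, smul_eq_mul, RingHom.id_apply, ← mul_sub, ← mul_sum]
    ring

lemma norm_cesaroDiff_le (ρ y : κ → Circle) (N : ℕ) (F : C(κ → Circle, ℂ)) :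
    ‖cesaroDiff ρ y N F‖ ≤ 2 * ‖F‖ := by
  have h : ‖∑ n ∈ range N, (F (y * ρ ^ n) - F (ρ ^ n))‖ ≤ N * (2 * ‖F‖) := by
    refine (norm_sum_le _ _).trans ?_
    refine (sum_le_card_nsmul _ _ (2 * ‖F‖) fun n _ => ?_).trans (by simp)
    refine (norm_sub_le _ _).trans ?_
    linarith [F.norm_coe_le_norm (y * ρ ^ n), F.norm_coe_le_norm (ρ ^ n)]
  rcases Nat.eq_zero_or_pos N with rfl | hN
  · simp [cesaroDiff]
  · have hN' : (0 : ℝ) < N := by exact_mod_cast hN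
    change ‖(N : ℂ)⁻¹ * _‖ ≤ _
    rw [norm_mul, norm_inv, Complex.norm_natCast, inv_mul_le_iff₀ hN']
    exact h

lemma tendsto_geom_mean {z : ℂ} (hz : ‖z‖ = 1) (h1 : z ≠ 1) :
    Tendsto (fun N : ℕ => (N : ℂ)⁻¹ * ∑ n ∈ range N, z ^ n) atTop (𝓝 0) := by
  have hz1 : 0 < ‖z - 1‖ := norm_pos_iff.2 (sub_ne_zero.2 h1)
  refine squeeze_zero_norm (a := fun N : ℕ => (N : ℝ)⁻¹ * (2 / ‖z - 1‖)) (fun N => ?_) ?_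
  · rw [geom_sum_eq h1, norm_mul, norm_inv, Complex.norm_natCast, norm_div]
    gcongr
    refine (norm_sub_le _ _).trans ?_
    rw [norm_pow, hz]
    norm_num
  · simpa using (tendsto_inv_atTop_nhds_zero_nat (𝕜 := ℝ)).mul_const (2 / ‖z - 1‖)

/-- The coordinate functions on the torus. -/
def torusCoord (i : κ) : C(κ → Circle, ℂ) := ⟨fun x => (x i : ℂ), by fun_prop⟩

lemma adjoin_torusCoord_topologicalClosure :
    (StarAlgebra.adjoin ℂ (Set.range (torusCoord (κ := κ)))).topologicalClosure = ⊤ := by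
  refine ContinuousMap.starSubalgebra_topologicalClosure_eq_top_of_separatesPoints _ ?_
  intro x y hxy
  obtain ⟨i, hi⟩ := Function.ne_iff.1 hxy
  refine ⟨torusCoord i, ⟨torusCoord i, StarAlgebra.subset_adjoin ℂ _ ⟨i, rfl⟩, rfl⟩, ?_⟩
  simpa [torusCoord, Circle.ext_iff] using hi

lemma tendsto_cesaroDiff_monomial {ρ : κ → Circle} (hρ : ∀ n, torusMonomial n ρ = 1 → n = 0)
    (y : κ → Circle) (n : κ →₀ ℤ) (F : C(κ → Circle, ℂ))
    (hF : ∀ x, F x = torusMonomial n x) :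
    Tendsto (fun N => cesaroDiff ρ y N F) atTop (𝓝 0) := by
  by_cases hn : torusMonomial n ρ = 1
  · obtain rfl := hρ n hn
    simp [cesaroDiff, hF, torusMonomial]
  · have := (tendsto_geom_mean (z := (torusMonomial n ρ : ℂ)) (Circle.norm_coe _)
      (by simpa [Circle.ext_iff] using hn)).const_mul ((torusMonomial n y : ℂ) - 1)
    rw [mul_zero] at this
    refine this.congr fun N => ?_
    simp only [cesaroDiff, LinearMap.coe_mk, AddHom.coe_mk, hF, torusMonomial_mul,
      torusMonomial_pow, Circle.coe_mul, Circle.coe_pow, ← sub_one_mul, ← mul_sum]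
    ring

lemma tendsto_cesaroDiff {ρ : κ → Circle} (hρ : ∀ n, torusMonomial n ρ = 1 → n = 0)
    (y : κ → Circle) (F : C(κ → Circle, ℂ)) :
    Tendsto (fun N => cesaroDiff ρ y N F) atTop (𝓝 0) := by
  classical
  have key : ∀ F ∈ StarAlgebra.adjoin ℂ (Set.range (torusCoord (κ := κ))),
      Tendsto (fun N => cesaroDiff ρ y N F) atTop (𝓝 0) := by
    intro F hF
    rw [← StarSubalgebra.mem_toSubalgebra, StarAlgebra.adjoin_toSubalgebra,
      ← Subalgebra.mem_toSubmodule, Algebra.adjoin_eq_span] at hF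
    induction hF using Submodule.span_induction with
    | mem F hF =>
      have : ∃ n : κ →₀ ℤ, ∀ x, F x = torusMonomial n x := by
        induction hF using Submonoid.closure_induction with
        | mem F hF =>
          rcases hF with ⟨i, rfl⟩ | ⟨i, hi⟩
          · exact ⟨Finsupp.single i 1, fun x => by simp [torusMonomial, torusCoord]⟩
          · refine ⟨Finsupp.single i (-1), fun x => ?_⟩
            rw [← star_star F, ← hi]
            have : torusMonomial (Finsupp.single i (-1)) x = (x i)⁻¹ := by
              rw [torusMonomial, Finsupp.prod_single_index (by simp), zpow_neg_one]
            rw [this, Circle.coe_inv_eq_conj]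
            simp [torusCoord]
        | one => exact ⟨0, fun x => by simp [torusMonomial]⟩
        | mul F G _ _ hF hG =>
          obtain ⟨n, hn⟩ := hF
          obtain ⟨m, hm⟩ := hG
          refine ⟨n + m, fun x => ?_⟩
          rw [ContinuousMap.mul_apply, hn, hm, torusMonomial, torusMonomial, torusMonomial,
            Finsupp.prod_add_index' (by simp) (fun _ _ _ => zpow_add _ _ _), Circle.coe_mul]
      obtain ⟨n, hn⟩ := this
      exact tendsto_cesaroDiff_monomial hρ y n F hn
    | zero => simp
    | add F G _ _ hF hG => simpa using hF.add hG
    | smul c F _ hF => simpa using hF.const_mul c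
  have hmem : F ∈ (StarAlgebra.adjoin ℂ (Set.range (torusCoord (κ := κ)))).topologicalClosure := by
    rw [adjoin_torusCoord_topologicalClosure]; trivial
  rw [← SetLike.mem_coe, StarSubalgebra.topologicalClosure_coe, Metric.mem_closure_iff] at hmem
  rw [Metric.tendsto_atTop]
  intro ε hε
  obtain ⟨G, hG, hd⟩ := hmem (ε / 4) (by positivity)
  obtain ⟨N₀, hN₀⟩ := Metric.tendsto_atTop.1 (key G hG) (ε / 2) (by positivity)
  refine ⟨N₀, fun N hN => ?_⟩
  have h1 := hN₀ N hN
  have h2 := norm_cesaroDiff_le ρ y N (F - G)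
  rw [dist_eq_norm] at hd
  rw [dist_zero_right] at h1 ⊢
  rw [map_sub] at h2
  have := norm_le_norm_add_norm_sub' (cesaroDiff ρ y N F) (cesaroDiff ρ y N G)
  linarith

/-- Along the powers of a rationally independent point of a torus, a continuous function can only
converge if it is constant. -/
lemma eq_const_of_tendsto_pow {ρ : κ → Circle} (hρ : ∀ n, torusMonomial n ρ = 1 → n = 0)
    (F : C(κ → Circle, ℂ)) (u : ℂ) (hF : Tendsto (fun n : ℕ => F (ρ ^ n)) atTop (𝓝 u))
    (x : κ → Circle) : F x = u := by
  by_contra hx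
  set g : (κ → Circle) → ℝ := fun x => ‖F x - u‖ with hg
  have hgc : Continuous g := by fun_prop
  set G : C(κ → Circle, ℂ) := ⟨fun x => (g x : ℂ), by fun_prop⟩
  have hmean : ∀ y, Tendsto (fun N : ℕ => (N : ℝ)⁻¹ * ∑ n ∈ range N, g (y * ρ ^ n)) atTop (𝓝 0) := by
    intro y
    have h0 : Tendsto (fun n : ℕ => g (ρ ^ n)) atTop (𝓝 0) := by
      simpa [hg] using (hF.sub_const u).norm
    have h1 := h0.cesaro
    have h2 := (Complex.continuous_re.tendsto _).comp (tendsto_cesaroDiff hρ y G)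
    have h3 := h2.add h1
    rw [Complex.zero_re, add_zero] at h3
    refine h3.congr fun N => ?_
    have : cesaroDiff ρ y N G =
        (((N : ℝ)⁻¹ * ∑ n ∈ range N, (g (y * ρ ^ n) - g (ρ ^ n)) : ℝ) : ℂ) := by
      simp [cesaroDiff, G]
    rw [Function.comp_apply, this, Complex.ofReal_re, sum_sub_distrib]
    ring
  have hgx : 0 < g x := norm_pos_iff.2 (sub_ne_zero.2 hx)
  set δ := g x / 2 with hδ
  have hopen : ∀ y : κ → Circle, IsOpen {z | δ < g (y * z)} := fun y =>
    isOpen_lt continuous_const (hgc.comp (continuous_const.mul continuous_id))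
  obtain ⟨t, ht⟩ := isCompact_univ.elim_finite_subcover _ hopen (fun z _ =>
    Set.mem_iUnion.2 ⟨x * z⁻¹, by simp [hδ, hgx]⟩)
  have hsum := tendsto_finsetSum t fun y _ => hmean y
  rw [sum_const_zero] at hsum
  refine absurd (ge_of_tendsto hsum (b := δ) ?_) (not_le.2 (by positivity))
  filter_upwards [eventually_gt_atTop 0] with N hN
  have hN' : (0 : ℝ) < N := by exact_mod_cast hN
  rw [← mul_sum, sum_comm, le_inv_mul_iff₀ hN']
  refine le_trans (by simp) (card_nsmul_le_sum (range N) _ δ fun n _ => ?_)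
  obtain ⟨y, hy⟩ := Set.mem_iUnion.1 (ht (Set.mem_univ (ρ ^ n)))
  obtain ⟨hyt, hy⟩ := Set.mem_iUnion.1 hy
  exact hy.le.trans (single_le_sum (f := fun y => g (y * ρ ^ n))
    (fun _ _ => norm_nonneg _) hyt)

/-- If `F` tends to `u` along the even powers and to `-u` along the odd powers of a rationally
independent point, then `F = 0` and `u = 0`. -/
lemma eq_zero_of_tendsto_neg_one_pow_mul {ρ : κ → Circle}
    (hρ : ∀ n, torusMonomial n ρ = 1 → n = 0) (F : C(κ → Circle, ℂ)) (u : ℂ)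
    (hF : Tendsto (fun n : ℕ => (-1) ^ n * F (ρ ^ (n + 1))) atTop (𝓝 u)) :
    F = 0 := by
  have hρ2 : ∀ n, torusMonomial n (ρ ^ 2) = 1 → n = 0 := by
    intro n hn
    have h2 : torusMonomial (2 • n) ρ = 1 := by
      rw [two_nsmul, torusMonomial, Finsupp.prod_add_index' (by simp) (fun _ _ _ => zpow_add _ _ _)]
      rwa [torusMonomial_pow, sq] at hn
    have := hρ _ h2
    ext i
    simpa using DFunLike.congr_fun this i
  have hodd : ∀ x, F x = -u := by
    refine eq_const_of_tendsto_pow hρ2 F (-u) ?_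
    have h := (hF.comp (tendsto_atTop_mono (fun n => (by omega : n ≤ 2 * n + 1)) tendsto_id)).neg
    rw [← tendsto_add_atTop_iff_nat 1]
    refine h.congr fun n => ?_
    have : (ρ ^ 2) ^ (n + 1) = ρ ^ (2 * n + 1 + 1) := by rw [← pow_mul]; ring_nf
    simp only [Function.comp_apply, this]
    simp [pow_succ (-1 : ℂ), pow_mul (-1 : ℂ)]
  have heven : -u = u := by
    refine tendsto_nhds_unique ?_
      (hF.comp (tendsto_atTop_mono (fun n => (by omega : n ≤ 2 * n)) tendsto_id))
    refine tendsto_const_nhds.congr fun n => ?_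
    simp [hodd, pow_mul]
  ext x
  rw [hodd x, neg_eq_self.1 heven]
  simp

end Kronecker

open Cardinal in
/-- A torus of dimension at most the continuum has a rationally independent point. -/
lemma exists_torusMonomial_independent {κ : Type} (hκ : Cardinal.mk κ ≤ Cardinal.continuum) :
    ∃ ρ : κ → Circle, ∀ n, torusMonomial n ρ = 1 → n = 0 := by
  let b := Module.Basis.ofVectorSpace ℚ ℝ
  have hb : Cardinal.mk (Module.Basis.ofVectorSpaceIndex ℚ ℝ) = 𝔠 := by
    rw [← Real.rank_rat_real, ← b.mk_eq_rank'']
  have hle : Cardinal.mk (Option κ) ≤ Cardinal.mk (Module.Basis.ofVectorSpaceIndex ℚ ℝ) := by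
    rw [hb, Cardinal.mk_option]
    exact Cardinal.add_le_of_le Cardinal.aleph0_le_continuum hκ
      (Cardinal.one_le_aleph0.trans Cardinal.aleph0_le_continuum)
  obtain ⟨j⟩ := hle
  have hli : LinearIndependent ℚ (b ∘ j) := b.linearIndependent.comp _ j.injective
  have hb0 : b (j none) ≠ 0 := b.ne_zero _
  refine ⟨fun i => Circle.exp (2 * Real.pi * (b (j (some i)) / b (j none))), fun n hn => ?_⟩
  have h1 : torusMonomial n (fun i => Circle.exp (2 * Real.pi * (b (j (some i)) / b (j none)))) =
      Circle.exp (2 * Real.pi * ((∑ i ∈ n.support, n i * b (j (some i))) / b (j none))) := by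
    have : 2 * Real.pi * ((∑ i ∈ n.support, n i * b (j (some i))) / b (j none)) =
      ∑ i ∈ n.support, n i • (2 * Real.pi * (b (j (some i)) / b (j none))) := by
      rw [Finset.sum_div, Finset.mul_sum]
      exact Finset.sum_congr rfl fun i _ => by rw [zsmul_eq_mul]; ring
    rw [this]
    have hexp : ∀ (s : Finset κ) (f : κ → ℝ),
        Circle.exp (∑ i ∈ s, f i) = ∏ i ∈ s, Circle.exp (f i) := by
      classical
      intro s f
      induction s using Finset.induction_on with
      | empty => simp
      | insert i s hi ih => rw [Finset.sum_insert hi, Finset.prod_insert hi, Circle.exp_add, ih]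
    simp only [torusMonomial, Finsupp.prod, ← Circle.exp_zsmul, hexp]
  rw [h1, Circle.exp_eq_one] at hn
  obtain ⟨m, hm⟩ := hn
  have hsum : ∑ i ∈ n.support, (n i : ℝ) * b (j (some i)) = m * b (j none) := by
    field_simp at hm
    linarith
  have hlin := linearIndependent_iff.1 hli
    (Finsupp.embDomain .some (n.mapRange (Int.cast : ℤ → ℚ) (by simp)) -
      Finsupp.single none (m : ℚ)) ?_
  · ext i
    have := DFunLike.congr_fun hlin (some i)
    simpa using this
  · rw [map_sub, Finsupp.linearCombination_embDomain, Finsupp.linearCombination_single,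
      Finsupp.linearCombination_apply, Finsupp.sum_mapRange_index (by simp), sub_eq_zero,
      Finsupp.sum]
    simpa [Rat.smul_def] using hsum
section RCLikeMap

variable {𝕂 : Type} [RCLike 𝕂]

lemma norm_rclikeMap (z : 𝕂) : ‖RCLike.map 𝕂 ℂ z‖ = ‖z‖ := by
  rw [← sq_eq_sq₀ (norm_nonneg _) (norm_nonneg _), RCLike.norm_sq_eq_def, RCLike.norm_sq_eq_def]
  simp

lemma rclikeMap_mul (z w : 𝕂) :
    RCLike.map 𝕂 ℂ (z * w) = RCLike.map 𝕂 ℂ z * RCLike.map 𝕂 ℂ w := by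
  apply Complex.ext <;> simp [RCLike.mul_re, RCLike.mul_im]

variable (𝕂) in
/-- `RCLike.map 𝕂 ℂ` as a ring homomorphism. -/
noncomputable def rclikeRingHom : 𝕂 →+* ℂ where
  toFun := RCLike.map 𝕂 ℂ
  map_one' := by simp
  map_zero' := map_zero _
  map_add' := map_add _
  map_mul' := rclikeMap_mul

end RCLikeMap

section Shift

set_option linter.unusedSectionVars false

open Filter

variable {𝕂 : Type} [RCLike 𝕂] {M Y : Type} [TopologicalSpace M] [CompactSpace M]
  [TopologicalSpace Y] [CompactSpace Y] [Group Y] [IsTopologicalGroup Y]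

/-- Restriction of a function on `M ⊕ Y ⊕ OnePoint ℕ` to `M`. -/
def restrictLeft : C(M ⊕ Y ⊕ OnePoint ℕ, 𝕂) →ₗ[𝕂] C(M, 𝕂) where
  toFun f := ⟨fun x => f (.inl x), by fun_prop⟩
  map_add' _ _ := rfl
  map_smul' _ _ := rfl

@[simp] lemma restrictLeft_apply (f : C(M ⊕ Y ⊕ OnePoint ℕ, 𝕂)) (x : M) :
    restrictLeft f x = f (.inl x) := rfl

lemma norm_restrictLeft_le (f : C(M ⊕ Y ⊕ OnePoint ℕ, 𝕂)) : ‖restrictLeft f‖ ≤ ‖f‖ :=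
  (ContinuousMap.norm_le _ (norm_nonneg _)).2 fun x => f.norm_coe_le_norm (.inl x)

/-- The value of the shift on the sequence part `OnePoint ℕ`: the value `a` is inserted at `0`, and
the other values are moved up by one place with a change of sign. -/
def seqShift (a : 𝕂) (u : OnePoint ℕ → 𝕂) : OnePoint ℕ → 𝕂
  | none => -u OnePoint.infty
  | some 0 => a
  | some (n + 1) => -u (n : ℕ)

lemma continuous_seqShift (a : 𝕂) {u : OnePoint ℕ → 𝕂} (hu : Continuous u) :
    Continuous (seqShift a u) := by
  rw [OnePoint.continuous_iff_from_nat] at hu ⊢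
  rw [← tendsto_add_atTop_iff_nat 1]
  exact hu.neg

variable (V : C(M, 𝕂) ≃ₗᵢ[𝕂] C(M, 𝕂)) (δ : C(M, 𝕂) →ₗ[𝕂] 𝕂) (ρ : Y)

/-- The functional inserted by the shift at the isolated point `0` of `OnePoint ℕ`. -/
noncomputable def insertedValue : C(M ⊕ Y ⊕ OnePoint ℕ, 𝕂) →ₗ[𝕂] 𝕂 where
  toFun f := δ (restrictLeft f) + 2⁻¹ * f (.inr (.inl 1))
  map_add' f g := by simp only [map_add, ContinuousMap.add_apply]; ring
  map_smul' c f := by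
    simp only [map_smul, ContinuousMap.smul_apply, smul_eq_mul, RingHom.id_apply]; ring

/-- The underlying function of the shift. -/
noncomputable def shiftFun (f : C(M ⊕ Y ⊕ OnePoint ℕ, 𝕂)) : C(M ⊕ Y ⊕ OnePoint ℕ, 𝕂) where
  toFun := Sum.elim (V.symm (restrictLeft f)) (Sum.elim (fun y => f (.inr (.inl (ρ⁻¹ * y))))
    (seqShift (insertedValue δ f) fun k => f (.inr (.inr k))))
  continuous_toFun := by
    refine (map_continuous _).sumElim (Continuous.sumElim (by fun_prop) ?_)
    exact continuous_seqShift _ (by fun_prop)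

/-- The shift as a linear map. -/
noncomputable def shiftLin : C(M ⊕ Y ⊕ OnePoint ℕ, 𝕂) →ₗ[𝕂] C(M ⊕ Y ⊕ OnePoint ℕ, 𝕂) where
  toFun := shiftFun V δ ρ
  map_add' f g := by
    ext (x | y | _ | _ | n)
    · exact congrArg (fun h : C(M, 𝕂) => h x) (map_add V.symm (restrictLeft f) (restrictLeft g))
    · rfl
    · exact neg_add _ _
    · exact map_add (insertedValue δ) f g
    · exact neg_add _ _
  map_smul' c f := by
    ext (x | y | _ | _ | n)
    · exact congrArg (fun h : C(M, 𝕂) => h x) (map_smul V.symm c (restrictLeft f))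
    · rfl
    · exact (mul_neg _ _).symm
    · exact map_smul (insertedValue δ) c f
    · exact (mul_neg _ _).symm

lemma shiftLin_restrictLeft (f : C(M ⊕ Y ⊕ OnePoint ℕ, 𝕂)) :
    restrictLeft (shiftLin V δ ρ f) = V.symm (restrictLeft f) := rfl

lemma shiftLin_middle (f : C(M ⊕ Y ⊕ OnePoint ℕ, 𝕂)) (y : Y) :
    shiftLin V δ ρ f (.inr (.inl y)) = f (.inr (.inl (ρ⁻¹ * y))) := rfl

lemma shiftLin_zero (f : C(M ⊕ Y ⊕ OnePoint ℕ, 𝕂)) :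
    shiftLin V δ ρ f (.inr (.inr (0 : ℕ))) = insertedValue δ f := rfl

lemma shiftLin_succ (f : C(M ⊕ Y ⊕ OnePoint ℕ, 𝕂)) (n : ℕ) :
    shiftLin V δ ρ f (.inr (.inr (n + 1 : ℕ))) = -f (.inr (.inr n)) := rfl

lemma shiftLin_infty (f : C(M ⊕ Y ⊕ OnePoint ℕ, 𝕂)) :
    shiftLin V δ ρ f (.inr (.inr OnePoint.infty)) = -f (.inr (.inr OnePoint.infty)) := rfl

lemma norm_shiftLin (hδ : ∀ f, ‖δ f‖ ≤ 2⁻¹ * ‖f‖) (f : C(M ⊕ Y ⊕ OnePoint ℕ, 𝕂)) :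
    ‖shiftLin V δ ρ f‖ = ‖f‖ := by
  apply le_antisymm
  · refine (ContinuousMap.norm_le _ (norm_nonneg _)).2 ?_
    rintro (x | y | _ | _ | n)
    · refine ((V.symm (restrictLeft f)).norm_coe_le_norm x).trans ?_
      rw [LinearIsometryEquiv.norm_map]
      exact norm_restrictLeft_le f
    · exact f.norm_coe_le_norm _
    · exact (norm_neg _).trans_le (f.norm_coe_le_norm _)
    · change ‖δ (restrictLeft f) + 2⁻¹ * f (.inr (.inl 1))‖ ≤ _
      refine (norm_add_le _ _).trans ?_
      have h1 := hδ (restrictLeft f)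
      have h2 := norm_restrictLeft_le f
      have h3 := f.norm_coe_le_norm (.inr (.inl 1))
      rw [norm_mul, norm_inv, RCLike.norm_ofNat]
      linarith
    · exact (norm_neg _).trans_le (f.norm_coe_le_norm _)
  · refine (ContinuousMap.norm_le _ (norm_nonneg _)).2 ?_
    set g := shiftLin V δ ρ f with hg
    rintro (x | y | _ | n)
    · refine ((restrictLeft f).norm_coe_le_norm x).trans ?_
      rw [← V.symm.norm_map, ← shiftLin_restrictLeft V δ ρ]
      exact norm_restrictLeft_le _
    · have := g.norm_coe_le_norm (.inr (.inl (ρ * y)))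
      rwa [hg, shiftLin_middle, inv_mul_cancel_left] at this
    · have := g.norm_coe_le_norm (.inr (.inr OnePoint.infty))
      rwa [hg, shiftLin_infty, norm_neg] at this
    · have := g.norm_coe_le_norm (.inr (.inr (n + 1 : ℕ)))
      rwa [hg, shiftLin_succ, norm_neg] at this

/-- The functional whose kernel is the range of the shift. -/
noncomputable def corangeFunctional : C(M ⊕ Y ⊕ OnePoint ℕ, 𝕂) →ₗ[𝕂] 𝕂 where
  toFun g := g (.inr (.inr (0 : ℕ))) - (δ (V (restrictLeft g)) + 2⁻¹ * g (.inr (.inl ρ)))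
  map_add' f g := by simp only [map_add, ContinuousMap.add_apply]; ring
  map_smul' c f := by
    simp only [map_smul, ContinuousMap.smul_apply, smul_eq_mul, RingHom.id_apply]; ring

lemma range_shiftLin :
    LinearMap.range (shiftLin (𝕂 := 𝕂) V δ ρ) = LinearMap.ker (corangeFunctional V δ ρ) := by
  ext g
  rw [LinearMap.mem_range, LinearMap.mem_ker]
  constructor
  · rintro ⟨f, rfl⟩
    change shiftLin V δ ρ f _ - (δ (V (restrictLeft (shiftLin V δ ρ f))) +
      2⁻¹ * shiftLin V δ ρ f _) = 0
    rw [shiftLin_zero, shiftLin_restrictLeft, shiftLin_middle, V.apply_symm_apply, inv_mul_cancel]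
    exact sub_self _
  · intro hg
    have hcont : Continuous fun k : OnePoint ℕ =>
        (k.elim (-g (.inr (.inr OnePoint.infty))) fun n : ℕ => -g (.inr (.inr (n + 1 : ℕ)))) := by
      rw [OnePoint.continuous_iff_from_nat]
      have : Continuous fun k : OnePoint ℕ => g (.inr (.inr k)) := by fun_prop
      rw [OnePoint.continuous_iff_from_nat, ← tendsto_add_atTop_iff_nat 1] at this
      exact this.neg
    refine ⟨⟨Sum.elim (V (restrictLeft g)) (Sum.elim (fun y => g (.inr (.inl (ρ * y)))) _),
      (map_continuous _).sumElim (Continuous.sumElim (by fun_prop) hcont)⟩, ?_⟩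
    ext (x | y | _ | _ | n)
    · exact congrArg (fun h : C(M, 𝕂) => h x) (V.symm_apply_apply (restrictLeft g))
    · exact congrArg (fun z => g (.inr (.inl z))) (mul_inv_cancel_left ρ y)
    · exact neg_neg _
    · have : g (.inr (.inl (ρ * 1))) = g (.inr (.inl ρ)) := by rw [mul_one]
      exact ((sub_eq_zero.1 hg).trans (by rw [← this]; rfl)).symm
    · exact neg_neg _

lemma rank_quotient_range_shiftLin :
    Module.rank 𝕂 (C(M ⊕ Y ⊕ OnePoint ℕ, 𝕂) ⧸ LinearMap.range (shiftLin (𝕂 := 𝕂) V δ ρ)) = 1 := by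
  rw [range_shiftLin]
  have hsurj : Function.Surjective (corangeFunctional (𝕂 := 𝕂) V δ ρ) := by
    intro c
    have hcont : Continuous fun k : OnePoint ℕ => (k.elim 0 fun n : ℕ => if n = 0 then c else 0) := by
      rw [OnePoint.continuous_iff_from_nat, ← tendsto_add_atTop_iff_nat 1]
      exact tendsto_const_nhds.congr fun n => by rfl
    refine ⟨⟨Sum.elim (0 : C(M, 𝕂)) (Sum.elim (fun _ => 0) _),
      (map_continuous _).sumElim (Continuous.sumElim continuous_const hcont)⟩, ?_⟩
    change c - (δ (V 0) + 2⁻¹ * 0) = c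
    simp
  rw [((corangeFunctional V δ ρ).quotKerEquivOfSurjective hsurj).rank_eq, Module.rank_self]

lemma restrictLeft_iterate (f : C(M ⊕ Y ⊕ OnePoint ℕ, 𝕂)) (n : ℕ) :
    (⇑V)^[n] (restrictLeft ((shiftLin V δ ρ)^[n] f)) = restrictLeft f := by
  induction n with
  | zero => rfl
  | succ n ih =>
    rw [Function.iterate_succ_apply, Function.iterate_succ_apply', shiftLin_restrictLeft,
      V.apply_symm_apply, ih]

lemma middle_iterate (f : C(M ⊕ Y ⊕ OnePoint ℕ, 𝕂)) (n : ℕ) (y : Y) :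
    (shiftLin V δ ρ)^[n] f (.inr (.inl (ρ ^ n * y))) = f (.inr (.inl y)) := by
  induction n with
  | zero => simp
  | succ n ih =>
    rw [Function.iterate_succ_apply', shiftLin_middle, pow_succ', mul_assoc, inv_mul_cancel_left, ih]

lemma seq_iterate (f : C(M ⊕ Y ⊕ OnePoint ℕ, 𝕂)) (n : ℕ) :
    (shiftLin V δ ρ)^[n + 1] f (.inr (.inr n)) = (-1) ^ n * insertedValue δ f := by
  induction n with
  | zero => simp [shiftLin_zero]
  | succ n ih =>
    rw [Function.iterate_succ_apply', shiftLin_succ, ih, pow_succ]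
    ring

lemma apply_nat_of_mem_iInter_range {f : C(M ⊕ Y ⊕ OnePoint ℕ, 𝕂)}
    (hf : f ∈ ⋂ n : ℕ, Set.range ((shiftLin V δ ρ)^[n + 1])) (n : ℕ) :
    f (.inr (.inr n)) =
      (-1) ^ n * (δ ((⇑V)^[n + 1] (restrictLeft f)) + 2⁻¹ * f (.inr (.inl (ρ ^ (n + 1))))) := by
  obtain ⟨g, rfl⟩ := Set.mem_iInter.1 hf n
  rw [seq_iterate, restrictLeft_iterate]
  have := middle_iterate V δ ρ g (n + 1) 1
  rw [mul_one] at this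
  rw [this]
  rfl

end Shift

lemma exists_isIsometricShift_of_recurrent {𝕂 : Type} [RCLike 𝕂] {M : Type} [TopologicalSpace M]
    [CompactSpace M] {ι : Type} {ρ : Option ι → Circle}
    (hρ : ∀ n, torusMonomial n ρ = 1 → n = 0)
    (V : C(M, 𝕂) ≃ₗᵢ[𝕂] C(M, 𝕂)) (δ : C(M, 𝕂) →ₗ[𝕂] 𝕂) (hδ : ∀ f, ‖δ f‖ ≤ 2⁻¹ * ‖f‖)
    (hV : ∀ g, ∃ K : C(Circle, ℂ), (∀ z, K (-z) = -K z) ∧ (K = 0 → g = 0) ∧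
      ∀ n : ℕ, RCLike.map 𝕂 ℂ (δ ((⇑V)^[n] g)) = K (ρ none ^ n)) :
    ∃ T : C(M ⊕ (ι → Circle) ⊕ OnePoint ℕ, 𝕂) →L[𝕂] C(M ⊕ (ι → Circle) ⊕ OnePoint ℕ, 𝕂),
      IsIsometricShift T := by
  set σ : ι → Circle := fun i => ρ (some i) with hσ
  refine ⟨(shiftLin V δ σ).mkContinuous 1 fun f => by rw [norm_shiftLin V δ σ hδ, one_mul],
    norm_shiftLin V δ σ hδ, rank_quotient_range_shiftLin V δ σ, ?_⟩
  refine Set.Subset.antisymm (fun f hf => ?_) ?_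
  · have hf' := apply_nat_of_mem_iInter_range V δ σ hf
    obtain ⟨K, hK, hK0, hKn⟩ := hV (restrictLeft f)
    set J := RCLike.map 𝕂 ℂ with hJ
    have hJinj : ∀ z, J z = 0 → z = 0 := fun z hz => by
      rw [← norm_eq_zero, ← norm_rclikeMap, ← hJ, hz, norm_zero]
    let F : C(Option ι → Circle, ℂ) :=
      ⟨fun x => K (x none) + 2⁻¹ * J (f (.inr (.inl fun i => x (some i)))), by fun_prop⟩
    have hFn : ∀ n : ℕ, J (f (.inr (.inr n))) = (-1) ^ n * F (ρ ^ (n + 1)) := fun n => by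
      have h1 : J ((-1) ^ n) = (-1) ^ n :=
        (map_pow (rclikeRingHom 𝕂) (-1) n).trans (by rw [map_neg, map_one])
      have h2 : J (2⁻¹) = 2⁻¹ :=
        (map_inv₀ (rclikeRingHom 𝕂) 2).trans (by rw [map_ofNat])
      rw [hf', hJ, rclikeMap_mul, map_add, rclikeMap_mul, hKn, ← hJ, h1, h2]
      rfl
    have hF : F = 0 := by
      refine eq_zero_of_tendsto_neg_one_pow_mul hρ F (J (f (.inr (.inr OnePoint.infty)))) ?_
      have hcont : Continuous fun k : OnePoint ℕ => J (f (.inr (.inr k))) := by fun_prop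
      refine ((OnePoint.continuous_iff_from_nat _).1 hcont).congr fun n => ?_
      exact hFn n
    have hKJ : ∀ z y, K z + 2⁻¹ * J (f (.inr (.inl y))) = 0 := fun z y =>
      congrArg (fun G : C(Option ι → Circle, ℂ) => G (fun o => o.elim z y)) hF
    have hKz : K = 0 := by
      ext z
      have h1 := hKJ z 1
      have h2 := hKJ (-z) 1
      rw [hK] at h2
      rw [ContinuousMap.zero_apply]
      linear_combination (h1 - h2) / 2
    have hM := hK0 hKz
    have hY : ∀ y, f (.inr (.inl y)) = 0 := fun y => hJinj _ (by simpa [hKz] using hKJ 1 y)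
    have hN : ∀ n : ℕ, f (.inr (.inr n)) = 0 := fun n => by
      exact hJinj _ (by rw [hFn, hF, ContinuousMap.zero_apply, mul_zero])
    rw [Set.mem_singleton_iff]
    ext (x | y | _ | n)
    · exact congrArg (fun h : C(M, 𝕂) => h x) hM
    · exact hY y
    · have hcont : Continuous fun k : OnePoint ℕ => f (.inr (.inr k)) := by fun_prop
      refine tendsto_nhds_unique ((OnePoint.continuous_iff_from_nat _).1 hcont) ?_
      simp [hN]
    · exact hN n
  · rintro _ rfl
    exact Set.mem_iInter.2 fun n => ⟨0, iterate_map_zero (shiftLin V δ σ) _⟩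

open MeasureTheory

section WeightedTranslation

variable {G : Type} [AddCommGroup G] [MeasurableSpace G] [MeasurableAdd G] {μ : Measure G}
  [μ.IsAddRightInvariant]

lemma ae_comp_add_right {p : G → Prop} (h : ∀ᵐ t ∂μ, p t) (s : G) : ∀ᵐ t ∂μ, p (t + s) :=
  (measurePreserving_add_right μ s).quasiMeasurePreserving.ae h

lemma memLp_weightedTranslation {f : G → ℂ} (hf : MemLp f ⊤ μ) {m : G → Circle}
    (hm : Measurable fun t => (m t : ℂ)) (s : G) :
    MemLp (fun t => (m t : ℂ) * f (t + s)) ⊤ μ := by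
  have h := hf.comp_measurePreserving (measurePreserving_add_right μ s)
  refine h.of_le (hm.aestronglyMeasurable.mul h.1) ?_
  exact .of_forall fun t => by simp [Circle.norm_coe]

/-- The isometry `f ↦ (t ↦ m t * f (t + s))` of `L^∞`. -/
noncomputable def weightedTranslation {m : G → Circle} (hm : Measurable fun t => (m t : ℂ)) (s : G) :
    Lp ℂ ⊤ μ →ₗᵢ[ℂ] Lp ℂ ⊤ μ where
  toFun f := (memLp_weightedTranslation (Lp.memLp f) hm s).toLp
  map_add' f g := by
    rw [← MemLp.toLp_add]
    refine MemLp.toLp_congr _ _ ?_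
    filter_upwards [ae_comp_add_right (Lp.coeFn_add f g) s] with t ht
    change (m t : ℂ) * (f + g : Lp ℂ ⊤ μ) (t + s) = m t * f (t + s) + m t * g (t + s)
    rw [ht, Pi.add_apply, mul_add]
  map_smul' a f := by
    rw [RingHom.id_apply, ← MemLp.toLp_const_smul]
    refine MemLp.toLp_congr _ _ ?_
    filter_upwards [ae_comp_add_right (Lp.coeFn_smul a f) s] with t ht
    change (m t : ℂ) * (a • f : Lp ℂ ⊤ μ) (t + s) = a * (m t * f (t + s))
    rw [ht, Pi.smul_apply, smul_eq_mul, mul_left_comm]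
  norm_map' f := by
    refine (Lp.norm_toLp _ (memLp_weightedTranslation (Lp.memLp f) hm s)).trans ?_
    rw [ Lp.norm_def]
    congr 1
    rw [← eLpNorm_comp_measurePreserving (Lp.aestronglyMeasurable f)
      (measurePreserving_add_right μ s)]
    exact eLpNorm_congr_norm_ae (.of_forall fun t => by simp [Circle.norm_coe])

lemma weightedTranslation_coeFn {m : G → Circle} (hm : Measurable fun t => (m t : ℂ)) (s : G) (f : Lp ℂ ⊤ μ) :
    weightedTranslation hm s f =ᵐ[μ] fun t => (m t : ℂ) * f (t + s) :=
  (memLp_weightedTranslation (Lp.memLp f) hm s).coeFn_toLp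

lemma weightedTranslation_surjective {m : G → Circle} (hm : Measurable fun t => (m t : ℂ)) (s : G) :
    Function.Surjective (weightedTranslation (μ := μ) hm s) := by
  intro h
  have hm' : Measurable fun t => (((m (t + -s))⁻¹ : Circle) : ℂ) := by
    simp only [Circle.coe_inv]
    exact (hm.comp (measurable_add_const (-s))).inv
  refine ⟨weightedTranslation hm' (-s) h, Lp.ext ?_⟩
  filter_upwards [weightedTranslation_coeFn hm s (weightedTranslation hm' (-s) h),
    ae_comp_add_right (weightedTranslation_coeFn hm' (-s) h) s] with t h1 h2
  rw [h1, h2, add_neg_cancel_right, ← mul_assoc, ← Circle.coe_mul, mul_inv_cancel, Circle.coe_one,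
    one_mul]

lemma weightedTranslation_iterate_coeFn {c : G → Circle} {ζ : Circle} {s : G}
    (hm : Measurable fun t => ((c t * ζ * (c (t + s))⁻¹ : Circle) : ℂ)) (f : Lp ℂ ⊤ μ) (n : ℕ) :
    (weightedTranslation hm s)^[n] f =ᵐ[μ]
      fun t => ((c t * ζ ^ n * (c (t + n • s))⁻¹ : Circle) : ℂ) * f (t + n • s) := by
  induction n with
  | zero => exact .of_forall fun t => by simp
  | succ n ih =>
    rw [Function.iterate_succ_apply']
    filter_upwards [weightedTranslation_coeFn hm s ((weightedTranslation hm s)^[n] f),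
      ae_comp_add_right ih s] with t h1 h2
    have e : t + (n + 1) • s = t + s + n • s := by rw [succ_nsmul', add_assoc]
    rw [h1, h2, e, ← mul_assoc, ← Circle.coe_mul]
    congr 2
    simp only [mul_assoc, inv_mul_cancel_left, pow_succ']
    rfl

end WeightedTranslation

section RealValued

variable {X : Type} [MeasurableSpace X] {μ : Measure X}

lemma ae_norm_le_norm_Lp_top (f : Lp ℂ ⊤ μ) : ∀ᵐ t ∂μ, ‖f t‖ ≤ ‖f‖ := by
  filter_upwards [enorm_ae_le_eLpNormEssSup f μ] with t ht
  rw [Lp.norm_def, eLpNorm_exponent_top, ← toReal_enorm]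
  refine ENNReal.toReal_mono ?_ ht
  have := Lp.eLpNorm_ne_top f
  rwa [eLpNorm_exponent_top] at this

variable [IsFiniteMeasure μ]

lemma im_eq_zero_of_forall_norm_sq_le {z : ℂ} {r : ℝ}
    (h : ∀ k : ℤ, ‖z + k * Complex.I‖ ^ 2 ≤ r + k ^ 2) : z.im = 0 := by
  have h' : ∀ k : ℤ, 2 * (k * z.im) ≤ r := fun k => by
    have := h k
    rw [Complex.sq_norm, Complex.normSq_apply] at this
    simp at this
    nlinarith [sq_nonneg z.re, sq_nonneg z.im]
  by_contra hz
  obtain ⟨n, hn⟩ := exists_nat_gt (r / (2 * |z.im|))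
  have hpos : 0 < |z.im| := abs_pos.2 hz
  rw [div_lt_iff₀ (by positivity)] at hn
  rcases abs_cases z.im with ⟨ha, _⟩ | ⟨ha, _⟩
  · have := h' n
    rw [ha] at hn
    push_cast at this
    linarith
  · have := h' (-n)
    rw [ha] at hn
    push_cast at this
    linarith

lemma norm_add_int_mul_I_sq {z : ℂ} (hz : z.im = 0) (k : ℤ) :
    ‖z + k * Complex.I‖ ^ 2 = ‖z‖ ^ 2 + k ^ 2 := by
  rw [Complex.sq_norm, Complex.normSq_apply, Complex.sq_norm, Complex.normSq_apply]
  simp [hz]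
  ring

lemma Lp_top_im_eq_zero_iff (f : Lp ℂ ⊤ μ) :
    (∀ᵐ t ∂μ, (f t).im = 0) ↔
      ∀ k : ℤ, ‖f + ((k : ℂ) * Complex.I) • Lp.const ⊤ μ (1 : ℂ)‖ ^ 2 ≤ ‖f‖ ^ 2 + k ^ 2 := by
  have key : ∀ k : ℤ, (f + ((k : ℂ) * Complex.I) • Lp.const ⊤ μ (1 : ℂ) : Lp ℂ ⊤ μ) =ᵐ[μ]
      fun t => f t + k * Complex.I := fun k => by
    filter_upwards [Lp.coeFn_add f (((k : ℂ) * Complex.I) • Lp.const ⊤ μ (1 : ℂ)),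
      Lp.coeFn_smul ((k : ℂ) * Complex.I) (Lp.const ⊤ μ (1 : ℂ)),
      Lp.coeFn_const (μ := μ) (p := ⊤) (1 : ℂ)] with t h1 h2 h3
    rw [h1, Pi.add_apply, h2, Pi.smul_apply, h3, Function.const_apply, smul_eq_mul, mul_one]
  constructor
  · intro h k
    refine (Real.le_sqrt (norm_nonneg _) (by positivity)).1 ?_
    have hb := Lp.norm_le_of_ae_bound (f := f + ((k : ℂ) * Complex.I) • Lp.const ⊤ μ (1 : ℂ))
      (Real.sqrt_nonneg (‖f‖ ^ 2 + (k : ℝ) ^ 2)) ?_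
    · simpa using hb
    filter_upwards [key k, h, ae_norm_le_norm_Lp_top f] with t h1 h2 h3
    refine Real.le_sqrt_of_sq_le ?_
    rw [h1, norm_add_int_mul_I_sq h2]
    gcongr
  · intro h
    have : ∀ᵐ t ∂μ, ∀ k : ℤ, ‖f t + k * Complex.I‖ ^ 2 ≤ ‖f‖ ^ 2 + k ^ 2 := by
      rw [ae_all_iff]
      intro k
      filter_upwards [key k, ae_norm_le_norm_Lp_top (f + ((k : ℂ) * Complex.I) • Lp.const ⊤ μ (1 : ℂ))]
        with t h1 h2
      rw [← h1]
      exact (pow_le_pow_left₀ (norm_nonneg _) h2 2).trans (h k)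
    filter_upwards [this] with t ht using im_eq_zero_of_forall_norm_sq_le ht

lemma continuousMap_im_eq_zero_iff {M : Type} [TopologicalSpace M] [CompactSpace M] (f : C(M, ℂ)) :
    (∀ t, (f t).im = 0) ↔
      ∀ k : ℤ, ‖f + ((k : ℂ) * Complex.I) • (1 : C(M, ℂ))‖ ^ 2 ≤ ‖f‖ ^ 2 + k ^ 2 := by
  constructor
  · intro h k
    refine (Real.le_sqrt (norm_nonneg _) (by positivity)).1 ?_
    refine (ContinuousMap.norm_le _ (Real.sqrt_nonneg _)).2 fun t => Real.le_sqrt_of_sq_le ?_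
    simp only [ContinuousMap.add_apply, ContinuousMap.smul_apply, ContinuousMap.one_apply,
      smul_eq_mul, mul_one]
    rw [norm_add_int_mul_I_sq (h t)]
    gcongr
    exact f.norm_coe_le_norm t
  · intro h t
    refine im_eq_zero_of_forall_norm_sq_le fun k => le_trans ?_ (h k)
    gcongr
    simpa using (f + ((k : ℂ) * Complex.I) • (1 : C(M, ℂ))).norm_coe_le_norm t

end RealValued

section Descent

variable {𝕂 : Type} [RCLike 𝕂] {M : Type} [TopologicalSpace M]

lemma rclikeMap_rclikeMap {z : ℂ} (h : (RCLike.I : 𝕂) = 0 → z.im = 0) :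
    RCLike.map 𝕂 ℂ (RCLike.map ℂ 𝕂 z) = z := by
  rcases RCLike.I_eq_zero_or_im_I_eq_one (K := 𝕂) with h0 | h1
  · have := h h0
    apply Complex.ext <;> simp [h0, this]
  · apply Complex.ext <;> simp [h1]

/-- Composition of a `𝕂`-valued function with the inclusion of `𝕂` in `ℂ`. -/
noncomputable def complexify (f : C(M, 𝕂)) : C(M, ℂ) :=
  ⟨fun x => RCLike.map 𝕂 ℂ (f x), by fun_prop⟩

@[simp] lemma complexify_apply (f : C(M, 𝕂)) (x : M) : complexify f x = RCLike.map 𝕂 ℂ (f x) := rfl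

lemma norm_complexify [CompactSpace M] (f : C(M, 𝕂)) : ‖complexify f‖ = ‖f‖ := by
  refine le_antisymm ?_ ?_
  · refine (ContinuousMap.norm_le _ (norm_nonneg _)).2 fun x => ?_
    rw [complexify_apply, norm_rclikeMap]
    exact f.norm_coe_le_norm x
  · refine (ContinuousMap.norm_le _ (norm_nonneg _)).2 fun x => ?_
    rw [← norm_rclikeMap]
    exact (complexify f).norm_coe_le_norm x

lemma complexify_add (f g : C(M, 𝕂)) : complexify (f + g) = complexify f + complexify g := by
  ext x
  exact map_add (RCLike.map 𝕂 ℂ) _ _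

lemma complexify_smul (a : 𝕂) (f : C(M, 𝕂)) :
    complexify (a • f) = RCLike.map 𝕂 ℂ a • complexify f := by
  ext x
  exact rclikeMap_mul _ _

lemma complexify_injective : Function.Injective (complexify : C(M, 𝕂) → C(M, ℂ)) := by
  intro f g h
  ext x
  have := congrArg (fun k : C(M, ℂ) => k x) h
  exact (rclikeRingHom 𝕂).injective this

lemma exists_complexify_eq_iff (h : C(M, ℂ)) :
    (∃ f : C(M, 𝕂), complexify f = h) ↔ ((RCLike.I : 𝕂) = 0 → ∀ x, (h x).im = 0) := by
  constructor
  · rintro ⟨f, rfl⟩ h0 x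
    have := RCLike.im_eq_zero h0 (f x)
    simp [this]
  · intro hh
    refine ⟨⟨fun x => RCLike.map ℂ 𝕂 (h x), by fun_prop⟩, ?_⟩
    ext x
    exact rclikeMap_rclikeMap fun h0 => hh h0 x

variable (𝕂) in
lemma exists_descent [CompactSpace M] (S : C(M, ℂ) →ₗᵢ[ℂ] C(M, ℂ)) (hS : Function.Surjective S)
    (hSim : ∀ f, (∀ x, (S f x).im = 0) ↔ ∀ x, (f x).im = 0)
    (D : C(M, ℂ) →ₗ[ℂ] ℂ) (hD : ∀ f, ‖D f‖ ≤ 2⁻¹ * ‖f‖)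
    (hDim : ∀ f, (∀ x, (f x).im = 0) → (D f).im = 0) :
    ∃ (V : C(M, 𝕂) ≃ₗᵢ[𝕂] C(M, 𝕂)) (δ : C(M, 𝕂) →ₗ[𝕂] 𝕂), (∀ f, ‖δ f‖ ≤ 2⁻¹ * ‖f‖) ∧
      ∀ g (n : ℕ), RCLike.map 𝕂 ℂ (δ ((⇑V)^[n] g)) = D ((⇑S)^[n] (complexify g)) := by
  have hV : ∀ f : C(M, 𝕂), ∃ g : C(M, 𝕂), complexify g = S (complexify f) := fun f =>
    (exists_complexify_eq_iff _).2 fun h0 => (hSim _).2 <|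
      (exists_complexify_eq_iff (complexify f)).1 ⟨f, rfl⟩ h0
  choose V hV using hV
  have hδ : ∀ f : C(M, 𝕂), ∃ z : 𝕂, RCLike.map 𝕂 ℂ z = D (complexify f) := fun f =>
    ⟨_, rclikeMap_rclikeMap fun h0 => hDim _ <|
      (exists_complexify_eq_iff (complexify f)).1 ⟨f, rfl⟩ h0⟩
  choose δ hδ using hδ
  let V' : C(M, 𝕂) →ₗᵢ[𝕂] C(M, 𝕂) :=
    { toFun := V
      map_add' := fun f g => complexify_injective (by
        rw [complexify_add, hV, hV, hV, complexify_add, map_add])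
      map_smul' := fun a f => complexify_injective (by
        rw [RingHom.id_apply, complexify_smul, hV, hV, complexify_smul, map_smul])
      norm_map' := fun f => by
        change ‖V f‖ = _
        rw [← norm_complexify, hV, S.norm_map, norm_complexify] }
  have hsurj : Function.Surjective V' := fun g => by
    obtain ⟨h, hh⟩ := hS (complexify g)
    obtain ⟨f, rfl⟩ := (exists_complexify_eq_iff (𝕂 := 𝕂) h).2 fun h0 => (hSim h).1 <| by
      rw [hh]
      exact (exists_complexify_eq_iff (complexify g)).1 ⟨g, rfl⟩ h0
    exact ⟨f, complexify_injective ((hV f).trans hh)⟩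
  let δ' : C(M, 𝕂) →ₗ[𝕂] 𝕂 :=
    { toFun := δ
      map_add' := fun f g => (rclikeRingHom 𝕂).injective (by
        change RCLike.map 𝕂 ℂ _ = RCLike.map 𝕂 ℂ _
        rw [map_add, hδ, hδ, hδ, complexify_add, map_add])
      map_smul' := fun a f => (rclikeRingHom 𝕂).injective (by
        change RCLike.map 𝕂 ℂ _ = RCLike.map 𝕂 ℂ _
        rw [RingHom.id_apply, smul_eq_mul, rclikeMap_mul, hδ, hδ, complexify_smul, map_smul,
          smul_eq_mul]) }
  refine ⟨.ofSurjective V' hsurj, δ', fun f => ?_, fun g n => ?_⟩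
  · rw [← norm_rclikeMap, ← norm_complexify]
    change ‖RCLike.map 𝕂 ℂ (δ f)‖ ≤ _
    rw [hδ]
    exact hD _
  · refine (hδ _).trans ?_
    congr 1
    exact (Function.Semiconj.iterate_right (f := complexify) (ga := V) (gb := S) hV n) g

end Descent

section HalfAngle

/-- The square root `exp (i x) ↦ exp (i x / 2)`, `0 < x ≤ 2π`, of the standard character. -/
noncomputable def halfAngle : AddCircle (2 * Real.pi) → Circle :=
  AddCircle.liftIoc (2 * Real.pi) 0 fun x => Circle.exp (x / 2)

lemma halfAngle_sq (t : AddCircle (2 * Real.pi)) :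
    halfAngle t ^ 2 = AddCircle.homeomorphCircle' t := by
  obtain ⟨x, hx, rfl⟩ : ∃ x ∈ Set.Ioc (0 : ℝ) (0 + 2 * Real.pi), (x : AddCircle (2 * Real.pi)) = t :=
    ⟨AddCircle.equivIoc (2 * Real.pi) 0 t, (AddCircle.equivIoc (2 * Real.pi) 0 t).2,
      (AddCircle.equivIoc (2 * Real.pi) 0).symm_apply_apply t⟩
  rw [halfAngle, AddCircle.liftIoc_coe_apply hx, AddCircle.homeomorphCircle'_apply_mk, pow_two,
    ← Circle.exp_add, add_halves]

lemma measurable_halfAngle : Measurable fun t => (halfAngle t : ℂ) := by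
  have : Measurable fun x : ℝ => (Circle.exp (x / 2) : ℂ) := by fun_prop
  exact (this.comp measurable_subtype_coe).comp
    (AddCircle.measurableEquivIoc (2 * Real.pi) 0).measurable

lemma fourierCoeff_halfAngle_ne_zero (n : ℤ) : fourierCoeff (fun t => (halfAngle t : ℂ)) n ≠ 0 := by
  have e : (fun t => (halfAngle t : ℂ)) = AddCircle.liftIoc (2 * Real.pi) 0
    fun x => Complex.exp ((x / 2 : ℝ) * Complex.I) := funext fun t => Circle.coe_exp _
  rw [e, fourierCoeff_liftIoc_eq, fourierCoeffOn_eq_integral]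
  have hn : (1 - 2 * n : ℂ) ≠ 0 := by
    exact_mod_cast (by omega : (1 - 2 * n : ℤ) ≠ 0)
  have hc : Complex.I * (1 - 2 * n) / 2 ≠ 0 := by simp [hn, Complex.I_ne_zero]
  have h : ∀ x : ℝ, fourier (-n) (x : AddCircle (0 + 2 * Real.pi - 0)) •
      Complex.exp ((x / 2 : ℝ) * Complex.I) =
      Complex.exp (Complex.I * (1 - 2 * n) / 2 * x) := fun x => by
    rw [fourier_coe_apply, smul_eq_mul, ← Complex.exp_add]
    congr 1
    push_cast
    have := Complex.ofReal_ne_zero.2 Real.pi_ne_zero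
    field_simp
    ring
  have h1 : Complex.exp (Complex.I * (1 - 2 * n) / 2 * (2 * Real.pi : ℝ)) = -1 := by
    have : Complex.I * (1 - 2 * n) / 2 * (2 * Real.pi : ℝ) =
        Real.pi * Complex.I + (-n : ℤ) * (2 * Real.pi * Complex.I) := by
      push_cast
      ring
    rw [this, Complex.exp_add, Complex.exp_int_mul_two_pi_mul_I, mul_one, Complex.exp_pi_mul_I]
  simp_rw [h]
  rw [integral_exp_mul_complex hc, zero_add, h1, Complex.ofReal_zero, mul_zero, Complex.exp_zero]
  refine smul_ne_zero (by simp [Real.pi_ne_zero]) (div_ne_zero (by norm_num) hc)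

end HalfAngle

section Correlation

variable {T : ℝ} [hT : Fact (0 < T)] {c q : AddCircle T → ℂ}

open AddCircle

lemma continuous_correlation (hc : MemLp c 2 haarAddCircle) (hq : MemLp q 2 haarAddCircle) :
    Continuous fun s => ∫ t, c t * q (t + s) ∂haarAddCircle := by
  have : Fact ((2 : ENNReal) ≠ ⊤) := ⟨by simp⟩
  have hcont : Continuous fun s : AddCircle T =>
      inner ℂ (hc.star.toLp) (DomAddAct.mk s +ᵥ hq.toLp) :=
    continuous_const.inner (DomAddAct.continuous_mk.vadd continuous_const)
  refine hcont.congr fun s => ?_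
  rw [L2.inner_def]
  refine integral_congr_ae ?_
  filter_upwards [hc.star.coeFn_toLp, DomAddAct.vadd_Lp_ae_eq (DomAddAct.mk s) hq.toLp,
    (measurePreserving_add_left haarAddCircle s).quasiMeasurePreserving.ae hq.coeFn_toLp]
    with t h1 h2 h3
  rw [h1, h2, Equiv.symm_apply_apply, vadd_eq_add, h3, add_comm s t]
  simp [mul_comm]

lemma fourierCoeff_mul_eq_zero_of_correlation (hc : Integrable c haarAddCircle)
    (hq : Integrable q haarAddCircle) (h : ∀ s, ∫ t, c t * q (t + s) ∂haarAddCircle = 0) (k : ℤ) :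
    fourierCoeff c (-k) * fourierCoeff q k = 0 := by
  have key : ∀ (n : ℤ) {f : AddCircle T → ℂ}, Integrable f haarAddCircle →
      Integrable (fun t => fourier n t * f t) haarAddCircle := fun n f hf =>
    hf.bdd_mul (c := 1) (fourier n).continuous.aestronglyMeasurable
      (.of_forall fun t => by simp [fourier_apply, Circle.norm_coe])
  set A : AddCircle T → ℂ := fun t => fourier k t * c t
  set B : AddCircle T → ℂ := fun t => fourier (-k) t * q t
  have hA : Integrable A haarAddCircle := key k hc
  have hB : Integrable B haarAddCircle := key (-k) hq
  have hprod : Integrable (fun z : AddCircle T × AddCircle T => A z.1 * B (z.1 + z.2))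
      (haarAddCircle.prod haarAddCircle) :=
    (measurePreserving_prod_add haarAddCircle haarAddCircle).integrable_comp_of_integrable
      (hA.mul_prod hB)
  have h1 : ∫ t, ∫ s, A t * B (t + s) ∂haarAddCircle ∂haarAddCircle =
      fourierCoeff c (-k) * fourierCoeff q k := by
    simp_rw [integral_const_mul, integral_add_left_eq_self]
    rw [integral_mul_const, fourierCoeff, fourierCoeff, neg_neg]
    rfl
  rw [← h1, integral_integral_swap hprod]
  have h2 : ∀ s, ∫ t, A t * B (t + s) ∂haarAddCircle = 0 := fun s => by
    have : ∀ t, A t * B (t + s) = fourier (-k) s * (c t * q (t + s)) := fun t => by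
      have h3 : fourier k t * fourier (-k) t = 1 := by
        rw [← fourier_add, add_neg_cancel, fourier_zero]
      have h4 : fourier (-k) (t + s) = fourier (-k) t * fourier (-k) s := by
        simp [fourier_apply, smul_add, AddCircle.toCircle_add]
      simp only [A, B]
      rw [h4]
      linear_combination (c t * q (t + s) * fourier (-k) s) * h3
    simp_rw [this]
    rw [integral_const_mul, h, mul_zero]
  simp [h2]

lemma ae_eq_zero_of_fourierCoeff_eq_zero (hq : MemLp q 2 haarAddCircle)
    (h : ∀ k, fourierCoeff q k = 0) : q =ᵐ[haarAddCircle] 0 := by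
  have h0 : hq.toLp = 0 := by
    rw [← (fourierBasis (T := T)).repr.map_eq_zero_iff]
    ext k
    rw [fourierBasis_repr, fourierCoeff_congr_ae hq.coeFn_toLp, h]
    rfl
  exact hq.coeFn_toLp.symm.trans (h0 ▸ Lp.coeFn_zero _ _ _)

end Correlation

section CircleRotation

lemma homeomorphCircle'_add (s t : AddCircle (2 * Real.pi)) :
    AddCircle.homeomorphCircle' (s + t) =
      AddCircle.homeomorphCircle' s * AddCircle.homeomorphCircle' t :=
  Real.Angle.toCircle_add s t

lemma homeomorphCircle'_nsmul (n : ℕ) (t : AddCircle (2 * Real.pi)) :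
    AddCircle.homeomorphCircle' (n • t) = AddCircle.homeomorphCircle' t ^ n := by
  induction n with
  | zero =>
    rw [zero_nsmul, pow_zero]
    exact Real.Angle.toCircle_zero
  | succ n ih => rw [succ_nsmul, homeomorphCircle'_add, ih, pow_succ]

lemma ae_haarAddCircle_iff {T : ℝ} [hT : Fact (0 < T)] {p : AddCircle T → Prop} :
    (∀ᵐ t ∂AddCircle.haarAddCircle, p t) ↔ ∀ᵐ t, p t := by
  rw [AddCircle.volume_eq_smul_haarAddCircle, Measure.ae_ennreal_smul_measure_iff]
  simpa using hT.out

lemma memLp_haarAddCircle {T : ℝ} [hT : Fact (0 < T)]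
    (f : Lp ℂ ⊤ (volume : Measure (AddCircle T))) (p : ENNReal) :
    MemLp f p AddCircle.haarAddCircle := by
  refine MemLp.of_bound ((Lp.aestronglyMeasurable f).mono_ac fun s hs => ?_) ‖f‖
    (ae_haarAddCircle_iff.2 (ae_norm_le_norm_Lp_top f))
  have := ae_haarAddCircle_iff.2 (measure_eq_zero_iff_ae_notMem.1 hs)
  exact measure_eq_zero_iff_ae_notMem.2 this

/-- Half of the mean value over the circle. -/
noncomputable def halfMean {T : ℝ} [hT : Fact (0 < T)] :
    Lp ℂ ⊤ (volume : Measure (AddCircle T)) →ₗ[ℂ] ℂ where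
  toFun f := 2⁻¹ * ∫ t, f t ∂AddCircle.haarAddCircle
  map_add' f g := by
    rw [integral_congr_ae (ae_haarAddCircle_iff.2 (Lp.coeFn_add f g)), ← mul_add]
    congr 1
    exact integral_add (memLp_one_iff_integrable.1 (memLp_haarAddCircle f 1))
      (memLp_one_iff_integrable.1 (memLp_haarAddCircle g 1))
  map_smul' a f := by
    rw [integral_congr_ae (ae_haarAddCircle_iff.2 (Lp.coeFn_smul a f))]
    simp only [Pi.smul_apply, integral_const_mul, RingHom.id_apply, smul_eq_mul]
    ring

lemma norm_halfMean_le {T : ℝ} [hT : Fact (0 < T)]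
    (f : Lp ℂ ⊤ (volume : Measure (AddCircle T))) : ‖halfMean f‖ ≤ 2⁻¹ * ‖f‖ := by
  have := norm_integral_le_of_norm_le_const
    (ae_haarAddCircle_iff.2 (ae_norm_le_norm_Lp_top f))
  change ‖2⁻¹ * ∫ t, f t ∂AddCircle.haarAddCircle‖ ≤ _
  rw [norm_mul]
  simp only [norm_inv, Complex.norm_ofNat]
  gcongr
  simpa using this

lemma halfMean_im_eq_zero {T : ℝ} [hT : Fact (0 < T)]
    {f : Lp ℂ ⊤ (volume : Measure (AddCircle T))} (hf : ∀ᵐ t, (f t).im = 0) :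
    (halfMean f).im = 0 := by
  have h : ∫ t, f t ∂AddCircle.haarAddCircle =
      ((∫ t, (f t).re ∂AddCircle.haarAddCircle : ℝ) : ℂ) := by
    refine Eq.trans (integral_congr_ae ?_) integral_ofReal
    filter_upwards [ae_haarAddCircle_iff.2 hf] with t ht
    exact Complex.ext (by simp) (by simp [ht])
  change (2⁻¹ * ∫ t, f t ∂AddCircle.haarAddCircle).im = 0
  rw [h]
  simp

variable {M : Type} [TopologicalSpace M] [CompactSpace M]
  {e : C(M, ℂ) ≃ₗᵢ[ℂ] Lp ℂ ⊤ (volume : Measure (AddCircle (2 * Real.pi)))}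

lemma map_one_of_map_mul
    (he : ∀ f g : C(M, ℂ),
      ((e (f * g) : AddCircle (2 * Real.pi) →ₘ[volume] ℂ)) = ↑(e f) * ↑(e g)) :
    e 1 = Lp.const ⊤ volume (1 : ℂ) := by
  have h := he 1 (e.symm (Lp.const ⊤ volume (1 : ℂ)))
  rw [one_mul, e.apply_symm_apply] at h
  have h1 : ((Lp.const ⊤ volume (1 : ℂ) : Lp ℂ ⊤ (volume : Measure (AddCircle (2 * Real.pi)))) :
    AddCircle (2 * Real.pi) →ₘ[volume] ℂ) = 1 := rfl
  refine Subtype.ext ?_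
  rw [h1, mul_one] at h
  exact h1.trans h |>.symm

lemma im_eq_zero_iff_of_map_mul
    (he : ∀ f g : C(M, ℂ),
      ((e (f * g) : AddCircle (2 * Real.pi) →ₘ[volume] ℂ)) = ↑(e f) * ↑(e g)) (f : C(M, ℂ)) :
    (∀ᵐ t, (e f t).im = 0) ↔ ∀ x, (f x).im = 0 := by
  rw [Lp_top_im_eq_zero_iff, continuousMap_im_eq_zero_iff, ← map_one_of_map_mul he, e.norm_map]
  simp only [← map_smul, ← map_add, e.norm_map]

variable (𝕂 : Type) [RCLike 𝕂]

lemma IsCMIsoLinftyCircle.exists_linearIsometryEquiv (hM : IsCMIsoLinftyCircle M) (ζ : Circle) :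
    ∃ (V : C(M, 𝕂) ≃ₗᵢ[𝕂] C(M, 𝕂)) (δ : C(M, 𝕂) →ₗ[𝕂] 𝕂), (∀ f, ‖δ f‖ ≤ 2⁻¹ * ‖f‖) ∧
      ∀ g, ∃ K : C(Circle, ℂ), (∀ z, K (-z) = -K z) ∧ (K = 0 → g = 0) ∧
        ∀ n : ℕ, RCLike.map 𝕂 ℂ (δ ((⇑V)^[n] g)) = K (ζ ^ n) := by
  obtain ⟨e, he⟩ := hM
  set s := (AddCircle.homeomorphCircle').symm (ζ ^ 2) with hs
  have hHs : AddCircle.homeomorphCircle' s = ζ ^ 2 := Homeomorph.apply_symm_apply _ _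
  have hm : Measurable fun t => ((halfAngle t * ζ * (halfAngle (t + s))⁻¹ : Circle) : ℂ) := by
    simp only [Circle.coe_mul, Circle.coe_inv]
    exact (measurable_halfAngle.mul_const _).mul
      (measurable_halfAngle.comp (measurable_add_const s)).inv
  have hm1 : ∀ t, ((halfAngle t * ζ * (halfAngle (t + s))⁻¹ : Circle) : ℂ) = 1 ∨
      ((halfAngle t * ζ * (halfAngle (t + s))⁻¹ : Circle) : ℂ) = -1 := fun t => by
    rw [← sq_eq_one_iff, ← Circle.coe_pow, mul_pow, mul_pow, inv_pow, halfAngle_sq, halfAngle_sq,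
      homeomorphCircle'_add, hHs, mul_inv_cancel, Circle.coe_one]
  set W : Lp ℂ ⊤ (volume : Measure (AddCircle (2 * Real.pi))) →ₗᵢ[ℂ] _ :=
    weightedTranslation hm s with hW
  have hWim : ∀ f, (∀ᵐ t, (W f t).im = 0) ↔ ∀ᵐ t, (f t).im = 0 := fun f => by
    have h1 : (∀ᵐ t, (W f t).im = 0) ↔ ∀ᵐ t, (f (t + s)).im = 0 := by
      refine Filter.eventually_congr ?_
      filter_upwards [weightedTranslation_coeFn hm s f] with t ht
      rw [ht]
      rcases hm1 t with h | h <;> simp [h]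
    rw [h1]
    refine ⟨fun h => ?_, fun h => ae_comp_add_right h s⟩
    simpa using ae_comp_add_right h (-s)
  let S : C(M, ℂ) →ₗᵢ[ℂ] C(M, ℂ) :=
    e.symm.toLinearIsometry.comp (W.comp e.toLinearIsometry)
  have hS : Function.Surjective S :=
    e.symm.surjective.comp ((weightedTranslation_surjective hm s).comp e.surjective)
  have heS : ∀ f, e (S f) = W (e f) := fun f => e.apply_symm_apply _
  have hSim : ∀ f, (∀ x, (S f x).im = 0) ↔ ∀ x, (f x).im = 0 := fun f => by
    rw [← im_eq_zero_iff_of_map_mul he, heS, hWim, im_eq_zero_iff_of_map_mul he]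
  obtain ⟨V, δ, hδ, hVδ⟩ := exists_descent 𝕂 S hS hSim (halfMean ∘ₗ e.toLinearEquiv.toLinearMap)
    (fun f => (norm_halfMean_le (e f)).trans_eq (by rw [e.norm_map]))
    (fun f hf => halfMean_im_eq_zero ((im_eq_zero_iff_of_map_mul he f).2 hf))
  refine ⟨V, δ, hδ, fun g => ?_⟩
  set q : AddCircle (2 * Real.pi) → ℂ := fun t => ((halfAngle t)⁻¹ : Circle) * e (complexify g) t
  have hq : MemLp q 2 AddCircle.haarAddCircle := by
    refine (memLp_haarAddCircle (e (complexify g)) 2).of_le ?_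
      (.of_forall fun t => by simp [q, Circle.norm_coe])
    simp only [q, Circle.coe_inv]
    exact measurable_halfAngle.inv.aestronglyMeasurable.mul
      (memLp_haarAddCircle (e (complexify g)) 2).1
  have hc : MemLp (fun t => (halfAngle t : ℂ)) 2 AddCircle.haarAddCircle :=
    MemLp.of_bound measurable_halfAngle.aestronglyMeasurable 1
      (.of_forall fun t => by simp [Circle.norm_coe])
  have hcont := continuous_correlation hc hq
  refine ⟨⟨fun z => 2⁻¹ * z * ∫ t, halfAngle t *
      q (t + (AddCircle.homeomorphCircle').symm (z ^ 2)) ∂AddCircle.haarAddCircle, ?_⟩,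
      fun z => ?_, fun hK => ?_, fun n => ?_⟩
  · have := hcont.comp
      ((AddCircle.homeomorphCircle').symm.continuous.comp (continuous_pow 2 (M := Circle)))
    exact (by fun_prop : Continuous fun z : Circle => (2⁻¹ * z : ℂ)).mul this
  · simp
  · have h0 : ∀ r, ∫ t, halfAngle t * q (t + r) ∂AddCircle.haarAddCircle = 0 := fun r => by
      have := congrArg (fun K : C(Circle, ℂ) => K (halfAngle r)) hK
      simp only [ContinuousMap.coe_mk, halfAngle_sq, Homeomorph.symm_apply_apply,
        ContinuousMap.zero_apply] at this
      exact (mul_eq_zero.1 this).resolve_left (mul_ne_zero (by norm_num) (Circle.coe_ne_zero _))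
    have hk : ∀ k, fourierCoeff q k = 0 := fun k =>
      (mul_eq_zero.1 (fourierCoeff_mul_eq_zero_of_correlation
        (hc.integrable (by norm_num)) (hq.integrable (by norm_num)) h0 k)).resolve_left
        (fourierCoeff_halfAngle_ne_zero _)
    have h1 := ae_haarAddCircle_iff.1 (ae_eq_zero_of_fourierCoeff_eq_zero hq hk)
    have h2 : e (complexify g) = 0 := by
      refine (Lp.eq_zero_iff_ae_eq_zero).2 ?_
      filter_upwards [h1] with t ht
      simpa [q] using ht
    rw [e.map_eq_zero_iff] at h2
    rw [← norm_eq_zero, ← norm_complexify, h2, norm_zero]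
  · rw [hVδ]
    have h1 : e (S^[n] (complexify g)) = W^[n] (e (complexify g)) :=
      (Function.Semiconj.iterate_right (f := e) (ga := S) (gb := W) heS n) _
    change 2⁻¹ * ∫ t, e (S^[n] (complexify g)) t ∂AddCircle.haarAddCircle = _
    rw [h1, integral_congr_ae (ae_haarAddCircle_iff.2
      (weightedTranslation_iterate_coeFn hm (e (complexify g)) n))]
    have h2 : (AddCircle.homeomorphCircle').symm ((ζ ^ n) ^ 2) = n • s := by
      rw [Homeomorph.symm_apply_eq, homeomorphCircle'_nsmul, hHs, pow_right_comm]
    rw [ContinuousMap.coe_mk, h2, mul_assoc, ← integral_const_mul ((ζ ^ n : Circle) : ℂ)]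
    refine congrArg ((2⁻¹ : ℂ) * ·) (integral_congr_ae (.of_forall fun t => ?_))
    simp only [q, Circle.coe_mul, Circle.coe_pow]
    ring

end CircleRotation

/-- If `C(M;ℂ) ≅ L^∞(𝕋)` isometrically as complex Banach algebras and `ι` is a nonempty
type of cardinality at most `𝔠`, then `C(M ⊕ 𝕋^ι ⊕ OnePoint ℕ; 𝕂)` admits an isometric
shift. -/
theorem stmt2 (𝕂 : Type) [RCLike 𝕂] (M : Type) [TopologicalSpace M] [CompactSpace M]
    [T2Space M] (hM : IsCMIsoLinftyCircle M) (ι : Type) [Nonempty ι]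
    (hι : Cardinal.mk ι ≤ Cardinal.continuum) :
    ∃ T : C(M ⊕ (ι → Circle) ⊕ OnePoint ℕ, 𝕂) →L[𝕂] C(M ⊕ (ι → Circle) ⊕ OnePoint ℕ, 𝕂),
      IsIsometricShift T := by
  have hκ : Cardinal.mk (Option ι) ≤ Cardinal.continuum := by
    rw [Cardinal.mk_option]
    exact Cardinal.add_le_of_le Cardinal.aleph0_le_continuum hι
      (Cardinal.one_le_aleph0.trans Cardinal.aleph0_le_continuum)
  obtain ⟨ρ, hρ⟩ := exists_torusMonomial_independent hκ
  obtain ⟨V, δ, hδ, hV⟩ := hM.exists_linearIsometryEquiv 𝕂 (ρ none)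
  exact exists_isIsometricShift_of_recurrent hρ V δ hδ hV
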